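/- For the induction motor model θ̇ = ω, ω̇ = μψ_d I_q − τ_L/J, ψ̇_d = −ηψ_d + ηM I_d, ρ̇ = n_pω + ηM I_q/ψ_d, İ_d = v_d, İ_q = v_q (constants μ, η, M, n_p, τ_L, J nonzero, on the domain ψ_d > 0), the distributions D₁ = span{∂_{I_d}, ∂_{I_q}}, D₂ = D₁ + [f, D₁], D₃ = D₂ + [D₂, D₂], D₄ = D₃ + [f, D₃] satisfy: D₂ = span{∂_{I_d}, ∂_{I_q}, ∂_{ψ_d}, ψ_d²μ∂_ω + Mη∂_ρ} (rank 4, non-involutive), D₃ = span{∂_{I_d}, ∂_{I_q}, ∂_{ψ_d}, ∂_ω, ∂_ρ} is involutive of rank 5, and D₄ is the full tangent bundle; moreover the annihilator of D₃ is spanned by dθ. -/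

import Mathlib

/-- Vector fields on `ℝⁿ`. -/
abbrev Vec (n : ℕ) := (Fin n → ℝ) → (Fin n → ℝ)

/-- Lie bracket of vector fields. -/
noncomputable def lieB {n : ℕ} (v w : Vec n) : Vec n :=
  fun x => fderiv ℝ w x (v x) - fderiv ℝ v x (w x)

/-- The `C^∞`-module generated by a set of vector fields. -/
def SmoothSpanV {n : ℕ} (S : Set (Vec n)) : Set (Vec n) :=
  {v | ∃ (k : ℕ) (c : Fin k → (Fin n → ℝ) → ℝ) (w : Fin k → Vec n),
        (∀ l, ContDiff ℝ (⊤ : ℕ∞) (c l)) ∧ (∀ l, w l ∈ S) ∧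
        v = fun x => ∑ l, c l x • w l x}

/-- Pointwise evaluation span of a family of vector fields. -/
noncomputable def ptSpan {n : ℕ} (S : Set (Vec n)) (x : Fin n → ℝ) :
    Submodule ℝ (Fin n → ℝ) :=
  Submodule.span ℝ ((fun v : Vec n => v x) '' S)

/-- Drift of the induction motor model; coordinates
`x = (θ, ω, ψ_d, ρ, I_d, I_q)` (indices `0,…,5`). -/
noncomputable def motorF (μ η M np τL J : ℝ) : Vec 6 :=
  fun x => ![x 1, μ * x 2 * x 5 - τL / J, -η * x 2 + η * M * x 4,
             np * x 1 + η * M * x 5 / x 2, 0, 0]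

/-- Input vector field `g₁ = ∂_{I_d}`. -/
noncomputable def motorG₁ : Vec 6 := fun _ => Pi.single 4 1

/-- Input vector field `g₂ = ∂_{I_q}`. -/
noncomputable def motorG₂ : Vec 6 := fun _ => Pi.single 5 1

/-- `D₁ = span{g₁, g₂}`. -/
def motorD₁ : Set (Vec 6) := SmoothSpanV {motorG₁, motorG₂}

/-- `D₂ = D₁ + [f, D₁]`. -/
def motorD₂ (μ η M np τL J : ℝ) : Set (Vec 6) :=
  SmoothSpanV (motorD₁ ∪ {u | ∃ v ∈ motorD₁, u = lieB (motorF μ η M np τL J) v})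

/-- `D₃ = D₂ + [D₂, D₂]`. -/
def motorD₃ (μ η M np τL J : ℝ) : Set (Vec 6) :=
  SmoothSpanV (motorD₂ μ η M np τL J ∪
    {u | ∃ v ∈ motorD₂ μ η M np τL J, ∃ w ∈ motorD₂ μ η M np τL J, u = lieB v w})

/-- `D₄ = D₃ + [f, D₃]`. -/
def motorD₄ (μ η M np τL J : ℝ) : Set (Vec 6) :=
  SmoothSpanV (motorD₃ μ η M np τL J ∪
    {u | ∃ v ∈ motorD₃ μ η M np τL J, u = lieB (motorF μ η M np τL J) v})

theorem sub_smooth {n : ℕ} (S : Set (Vec n)) : S ⊆ SmoothSpanV S := by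
  intro v hv
  refine ⟨1, fun _ _ => 1, fun _ => v, fun _ => contDiff_const, fun _ => hv, ?_⟩
  funext x
  simp

theorem ptSpan_smooth {n : ℕ} (S : Set (Vec n)) (x : Fin n → ℝ) :
    ptSpan (SmoothSpanV S) x = ptSpan S x := by
  apply le_antisymm
  · refine Submodule.span_le.2 ?_
    rintro _ ⟨v, ⟨k, c, w, hc, hw, rfl⟩, rfl⟩
    exact Submodule.sum_mem _ fun l _ => Submodule.smul_mem _ _
      (Submodule.subset_span ⟨w l, hw l, rfl⟩)
  · exact Submodule.span_mono (Set.image_mono (sub_smooth S))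

theorem mem_ptSpan {n : ℕ} {S : Set (Vec n)} {v : Vec n} (hv : v ∈ S) (x : Fin n → ℝ) :
    v x ∈ ptSpan S x := Submodule.subset_span ⟨v, hv, rfl⟩

theorem fderiv_comp_zero {v : Vec 6} {x : Fin 6 → ℝ} {i : Fin 6}
    (h : ∀ᶠ y in nhds x, v y i = 0) (u : Fin 6 → ℝ) : fderiv ℝ v x u i = 0 := by
  by_cases hd : DifferentiableAt ℝ v x
  · have h1 := (hasFDerivAt_pi'.1 hd.hasFDerivAt) i
    have h2 : HasFDerivAt (fun y => v y i) (0 : (Fin 6 → ℝ) →L[ℝ] ℝ) x :=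
      (hasFDerivAt_const (0 : ℝ) x).congr_of_eventuallyEq h
    have h3 := congrArg (fun L => L u) (h1.unique h2)
    simpa using h3
  · simp [fderiv_zero_of_not_differentiableAt hd]

theorem ev_pos {x : Fin 6 → ℝ} (hx : x 2 > 0) : ∀ᶠ y in nhds x, y 2 > 0 :=
  (continuous_apply (2 : Fin 6)).continuousAt.eventually (lt_mem_nhds hx)

theorem fderiv_motorF (μ η M np τL J : ℝ) {x : Fin 6 → ℝ} (hx : x 2 > 0) (u : Fin 6 → ℝ) :
    fderiv ℝ (motorF μ η M np τL J) x u =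
      ![u 1, μ * (x 2 * u 5 + x 5 * u 2), -η * u 2 + η * M * u 4,
        np * u 1 + η * M * (u 5 / x 2 - x 5 * u 2 / x 2 ^ 2), 0, 0] := by
  have hx' : x 2 ≠ 0 := hx.ne'
  have h (i : Fin 6) : HasFDerivAt (fun y : Fin 6 → ℝ => y i)
      (ContinuousLinearMap.proj i : (Fin 6 → ℝ) →L[ℝ] ℝ) x := hasFDerivAt_apply i x
  have hinv := (hasDerivAt_inv hx').comp_hasFDerivAt x (h 2)
  have h1 := (((h 2).const_mul μ).mul (h 5)).sub_const (τL / J)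
  have h2 := ((h 2).const_mul (-η)).add ((h 4).const_mul (η * M))
  have h3 := ((h 1).const_mul np).add (((h 5).const_mul (η * M)).mul hinv)
  have h0 := hasFDerivAt_const (𝕜 := ℝ) (0 : ℝ) x
  have hd : DifferentiableAt ℝ (motorF μ η M np τL J) x := by
    rw [differentiableAt_pi]
    intro i
    fin_cases i
    · exact (h 1).differentiableAt
    · exact h1.differentiableAt
    · exact h2.differentiableAt
    · exact h3.differentiableAt
    · exact h0.differentiableAt
    · exact h0.differentiableAt
  have hc := hasFDerivAt_pi'.1 hd.hasFDerivAt
  funext i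
  have key (L : (Fin 6 → ℝ) →L[ℝ] ℝ)
      (hL : HasFDerivAt (fun y => motorF μ η M np τL J y i) L x) :
      fderiv ℝ (motorF μ η M np τL J) x u i = L u := by
    have := congrArg (fun L => L u) ((hc i).unique hL)
    simpa using this
  fin_cases i
  · exact key _ (h 1)
  · rw [key _ h1]; simp; ring
  · rw [key _ h2]; simp
  · rw [key _ h3]; simp; field_simp; ring
  · exact key _ h0
  · exact key _ h0

theorem D1_zero {v : Vec 6} (hv : v ∈ motorD₁) (y : Fin 6 → ℝ) :
    v y 0 = 0 ∧ v y 1 = 0 ∧ v y 2 = 0 ∧ v y 3 = 0 := by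
  obtain ⟨k, c, w, hc, hw, rfl⟩ := hv
  have hz : ∀ i : Fin 6, i ≠ 4 → i ≠ 5 → (∑ l, c l y • w l y) i = 0 := by
    intro i h4 h5
    rw [Finset.sum_apply]
    refine Finset.sum_eq_zero fun l _ => ?_
    rcases hw l with h | h
    · rw [h]; simp [motorG₁, h4]
    · rw [Set.mem_singleton_iff.1 h]; simp [motorG₂, h5]
  exact ⟨hz 0 (by decide) (by decide), hz 1 (by decide) (by decide),
    hz 2 (by decide) (by decide), hz 3 (by decide) (by decide)⟩

/-- The pointwise model of `D₂`. -/
def Kx (μ η M : ℝ) (x : Fin 6 → ℝ) : Submodule ℝ (Fin 6 → ℝ) where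
  carrier := {v | v 0 = 0 ∧ M * η * v 1 = μ * x 2 ^ 2 * v 3}
  zero_mem' := by simp
  add_mem' := by
    rintro a b ⟨h1, h2⟩ ⟨h3, h4⟩
    refine ⟨by simp [h1, h3], ?_⟩
    simp only [Pi.add_apply]
    linear_combination h2 + h4
  smul_mem' := by
    rintro c a ⟨h1, h2⟩
    refine ⟨by simp [h1], ?_⟩
    simp only [Pi.smul_apply, smul_eq_mul]
    linear_combination c * h2

theorem D2_le (μ η M np τL J : ℝ) {x : Fin 6 → ℝ} (hx : x 2 > 0) :
    ptSpan (motorD₂ μ η M np τL J) x ≤ Kx μ η M x := by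
  rw [motorD₂, ptSpan_smooth]
  refine Submodule.span_le.2 ?_
  rintro _ ⟨v, hv | ⟨w, hw, rfl⟩, rfl⟩
  · have := D1_zero hv x
    exact ⟨this.1, by simp [this]⟩
  · have h := D1_zero hw
    have e0 := fderiv_comp_zero (Filter.Eventually.of_forall fun y => (h y).1)
      (motorF μ η M np τL J x) (x := x)
    have e1 := fderiv_comp_zero (Filter.Eventually.of_forall fun y => (h y).2.1)
      (motorF μ η M np τL J x) (x := x)
    have e3 := fderiv_comp_zero (Filter.Eventually.of_forall fun y => (h y).2.2.2)
      (motorF μ η M np τL J x) (x := x)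
    obtain ⟨h0, h1, h2, h3⟩ := h x
    constructor
    · simp [lieB, fderiv_motorF μ η M np τL J hx, e0, h1]
    · simp [lieB, fderiv_motorF μ η M np τL J hx, e1, e3, h1, h2]
      field_simp

theorem K_le (μ η M : ℝ) (hη : η ≠ 0) (hM : M ≠ 0) (x : Fin 6 → ℝ) :
    Kx μ η M x ≤ Submodule.span ℝ
              {Pi.single 4 1, Pi.single 5 1, Pi.single 2 1,
                (μ * (x 2) ^ 2) • (Pi.single 1 1 : Fin 6 → ℝ)
                  + (M * η) • (Pi.single 3 1 : Fin 6 → ℝ)} := by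
  rintro v ⟨h0, h1⟩
  have : v = v 4 • Pi.single 4 1 + v 5 • Pi.single 5 1 + v 2 • Pi.single 2 1 +
      (v 3 / (M * η)) • ((μ * (x 2) ^ 2) • (Pi.single 1 1 : Fin 6 → ℝ)
                  + (M * η) • (Pi.single 3 1 : Fin 6 → ℝ)) := by
    funext i
    fin_cases i <;> simp [h0]
    · field_simp; linear_combination h1
    · field_simp
  rw [this]
  refine Submodule.add_mem _ (Submodule.add_mem _ (Submodule.add_mem _ ?_ ?_) ?_) ?_ <;>
    exact Submodule.smul_mem _ _ (Submodule.subset_span (by simp))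

theorem G1_mem : motorG₁ ∈ motorD₁ := sub_smooth _ (by simp)
theorem G2_mem : motorG₂ ∈ motorD₁ := sub_smooth _ (by simp)

theorem lie_G1 (μ η M np τL J : ℝ) {x : Fin 6 → ℝ} (hx : x 2 > 0) :
    lieB (motorF μ η M np τL J) motorG₁ x = ![0, 0, -(η * M), 0, 0, 0] := by
  have : fderiv ℝ motorG₁ x = 0 := by unfold motorG₁; simp
  simp only [lieB, this, fderiv_motorF μ η M np τL J hx]
  funext i
  fin_cases i <;> simp [motorG₁]

theorem lie_G2 (μ η M np τL J : ℝ) {x : Fin 6 → ℝ} (hx : x 2 > 0) :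
    lieB (motorF μ η M np τL J) motorG₂ x = ![0, -(μ * x 2), 0, -(η * M * (x 2)⁻¹), 0, 0] := by
  have : fderiv ℝ motorG₂ x = 0 := by unfold motorG₂; simp
  simp only [lieB, this, fderiv_motorF μ η M np τL J hx]
  funext i
  fin_cases i <;> simp [motorG₂]

theorem w1_mem (μ η M np τL J : ℝ) :
    lieB (motorF μ η M np τL J) motorG₁ ∈ motorD₂ μ η M np τL J :=
  sub_smooth _ (Or.inr ⟨_, G1_mem, rfl⟩)

theorem w2_mem (μ η M np τL J : ℝ) :
    lieB (motorF μ η M np τL J) motorG₂ ∈ motorD₂ μ η M np τL J :=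
  sub_smooth _ (Or.inr ⟨_, G2_mem, rfl⟩)

theorem span_le_D2 (μ η M np τL J : ℝ) (hη : η ≠ 0) (hM : M ≠ 0)
    {x : Fin 6 → ℝ} (hx : x 2 > 0) :
    Submodule.span ℝ
              {Pi.single 4 1, Pi.single 5 1, Pi.single 2 1,
                (μ * (x 2) ^ 2) • (Pi.single 1 1 : Fin 6 → ℝ)
                  + (M * η) • (Pi.single 3 1 : Fin 6 → ℝ)} ≤
      ptSpan (motorD₂ μ η M np τL J) x := by
  have hx' : x 2 ≠ 0 := hx.ne'
  have m1 := mem_ptSpan (w1_mem μ η M np τL J) x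
  have m2 := mem_ptSpan (w2_mem μ η M np τL J) x
  rw [lie_G1 _ _ _ _ _ _ hx] at m1
  rw [lie_G2 _ _ _ _ _ _ hx] at m2
  refine Submodule.span_le.2 ?_
  rintro v (rfl | rfl | rfl | h) <;> rw [SetLike.mem_coe]
  · exact mem_ptSpan (sub_smooth _ (Or.inl G1_mem) : motorG₁ ∈ motorD₂ μ η M np τL J) x
  · exact mem_ptSpan (sub_smooth _ (Or.inl G2_mem) : motorG₂ ∈ motorD₂ μ η M np τL J) x
  · convert Submodule.smul_mem _ (-(η * M)⁻¹) m1 using 1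
    funext i
    fin_cases i <;> simp
    field_simp
  · rw [Set.mem_singleton_iff.1 h]
    convert Submodule.smul_mem _ (-(x 2)) m2 using 1
    funext i
    fin_cases i <;> simp <;> field_simp

theorem D2_eq (μ η M np τL J : ℝ) (hη : η ≠ 0) (hM : M ≠ 0)
    {x : Fin 6 → ℝ} (hx : x 2 > 0) :
    ptSpan (motorD₂ μ η M np τL J) x = Submodule.span ℝ
              {Pi.single 4 1, Pi.single 5 1, Pi.single 2 1,
                (μ * (x 2) ^ 2) • (Pi.single 1 1 : Fin 6 → ℝ)
                  + (M * η) • (Pi.single 3 1 : Fin 6 → ℝ)} :=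
  le_antisymm ((D2_le μ η M np τL J hx).trans (K_le μ η M hη hM x))
    (span_le_D2 μ η M np τL J hη hM hx)

theorem rank_span_motor (a b : ℝ) (hb : b ≠ 0) :
    Module.finrank ℝ (Submodule.span ℝ
              ({Pi.single 4 1, Pi.single 5 1, Pi.single 2 1,
                a • (Pi.single 1 1 : Fin 6 → ℝ)
                  + b • (Pi.single 3 1 : Fin 6 → ℝ)} : Set (Fin 6 → ℝ))) = 4 := by
  have hli : LinearIndependent ℝ (![Pi.single 4 1, Pi.single 5 1, Pi.single 2 1,
                a • (Pi.single 1 1 : Fin 6 → ℝ)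
                  + b • (Pi.single 3 1 : Fin 6 → ℝ)] : Fin 4 → Fin 6 → ℝ) := by
    rw [Fintype.linearIndependent_iff]
    intro g hg
    have e (i : Fin 6) := congrFun hg i
    have e4 := e 4
    have e5 := e 5
    have e2 := e 2
    have e3 := e 3
    simp [Fin.sum_univ_succ, hb] at e4 e5 e2 e3
    intro i
    fin_cases i <;> simp [*]
  have := finrank_span_eq_card hli
  rw [Fintype.card_fin] at this
  refine Eq.trans ?_ this
  have hr : Set.range (![Pi.single 4 1, Pi.single 5 1, Pi.single 2 1,
                a • (Pi.single 1 1 : Fin 6 → ℝ)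
                  + b • (Pi.single 3 1 : Fin 6 → ℝ)] : Fin 4 → Fin 6 → ℝ) =
      {Pi.single 4 1, Pi.single 5 1, Pi.single 2 1,
                a • (Pi.single 1 1 : Fin 6 → ℝ)
                  + b • (Pi.single 3 1 : Fin 6 → ℝ)} := by
    ext v
    simp only [Set.mem_insert_iff, Set.mem_singleton_iff, Set.mem_range]
    constructor
    · rintro ⟨i, rfl⟩
      fin_cases i <;> simp
    · rintro (rfl | rfl | rfl | rfl)
      exacts [⟨0, rfl⟩, ⟨1, rfl⟩, ⟨2, rfl⟩, ⟨3, rfl⟩]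
  exact congrArg (fun S : Set (Fin 6 → ℝ) => Module.finrank ℝ (Submodule.span ℝ S)) hr.symm

theorem lie_w (μ η M np τL J : ℝ) {x : Fin 6 → ℝ} (hx : x 2 > 0) :
    lieB (lieB (motorF μ η M np τL J) motorG₁) (lieB (motorF μ η M np τL J) motorG₂) x =
      ![0, η * M * μ, 0, -(η * M) ^ 2 / x 2 ^ 2, 0, 0] := by
  have hx' : x 2 ≠ 0 := hx.ne'
  have E1 : lieB (motorF μ η M np τL J) motorG₁ =ᶠ[nhds x]
      fun _ => ![0, 0, -(η * M), 0, 0, 0] := (ev_pos hx).mono fun y hy => lie_G1 _ _ _ _ _ _ hy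
  have E2 : lieB (motorF μ η M np τL J) motorG₂ =ᶠ[nhds x]
      fun y => ![0, -(μ * y 2), 0, -(η * M * (y 2)⁻¹), 0, 0] :=
    (ev_pos hx).mono fun y hy => lie_G2 _ _ _ _ _ _ hy
  have h2 : HasFDerivAt (fun y : Fin 6 → ℝ => y 2)
      (ContinuousLinearMap.proj 2 : (Fin 6 → ℝ) →L[ℝ] ℝ) x := hasFDerivAt_apply 2 x
  have h0 := hasFDerivAt_const (𝕜 := ℝ) (0 : ℝ) x
  have hinv := (hasDerivAt_inv hx').comp_hasFDerivAt x h2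
  have k1 := (h2.const_mul μ).neg
  have k3 := (hinv.const_mul (η * M)).neg
  have hF : HasFDerivAt (fun y : Fin 6 → ℝ =>
      (![0, -(μ * y 2), 0, -(η * M * (y 2)⁻¹), 0, 0] : Fin 6 → ℝ))
      (ContinuousLinearMap.pi (![0, -(μ • ContinuousLinearMap.proj 2), 0,
        -((η * M) • (-(x 2 ^ 2)⁻¹ • ContinuousLinearMap.proj 2)), 0, 0] :
        Fin 6 → (Fin 6 → ℝ) →L[ℝ] ℝ)) x := by
    rw [hasFDerivAt_pi']
    intro i
    fin_cases i
    · exact h0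
    · exact k1
    · exact h0
    · exact k3
    · exact h0
    · exact h0
  rw [lieB, E1.fderiv_eq, E2.fderiv_eq, hF.fderiv, lie_G1 _ _ _ _ _ _ hx]
  funext i
  fin_cases i <;> simp
  · ring
  · field_simp

theorem D2_zero (μ η M np τL J : ℝ) {v : Vec 6} (hv : v ∈ motorD₂ μ η M np τL J)
    {x : Fin 6 → ℝ} (hx : x 2 > 0) : v x 0 = 0 :=
  (D2_le μ η M np τL J hx (mem_ptSpan hv x)).1

theorem lieB_zero_comp {v w : Vec 6} (hv : ∀ y : Fin 6 → ℝ, y 2 > 0 → v y 0 = 0)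
    (hw : ∀ y : Fin 6 → ℝ, y 2 > 0 → w y 0 = 0) {x : Fin 6 → ℝ} (hx : x 2 > 0) :
    lieB v w x 0 = 0 := by
  simp [lieB, fderiv_comp_zero ((ev_pos hx).mono hv), fderiv_comp_zero ((ev_pos hx).mono hw)]

theorem D3_eq (μ η M np τL J : ℝ) (hμ : μ ≠ 0) (hη : η ≠ 0) (hM : M ≠ 0)
    {x : Fin 6 → ℝ} (hx : x 2 > 0) :
    ptSpan (motorD₃ μ η M np τL J) x
          = LinearMap.ker (LinearMap.proj 0 : ((i : Fin 6) → ℝ) →ₗ[ℝ] ℝ) := by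
  have hx' : x 2 ≠ 0 := hx.ne'
  apply le_antisymm
  · rw [motorD₃, ptSpan_smooth]
    refine Submodule.span_le.2 ?_
    rintro _ ⟨v, hv | ⟨a, ha, b, hb, rfl⟩, rfl⟩
    · exact D2_zero μ η M np τL J hv hx
    · exact lieB_zero_comp (fun y hy => D2_zero μ η M np τL J ha hy)
        (fun y hy => D2_zero μ η M np τL J hb hy) hx
  · intro v hv
    have hv0 : v 0 = 0 := hv
    have hle : ptSpan (motorD₂ μ η M np τL J) x ≤ ptSpan (motorD₃ μ η M np τL J) x :=
      Submodule.span_mono (Set.image_mono (Set.subset_union_left.trans (sub_smooth _)))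
    have m := mem_ptSpan (sub_smooth _ (Or.inr ⟨_, w1_mem μ η M np τL J, _,
      w2_mem μ η M np τL J, rfl⟩) : _ ∈ motorD₃ μ η M np τL J) x
    rw [lie_w _ _ _ _ _ _ hx] at m
    -- choose the multiple of the bracket so that the remainder is in `D₂`
    set c : ℝ := (M * η * v 1 - μ * x 2 ^ 2 * v 3) / (2 * μ * (η * M) ^ 2) with hc
    have hr : v - c • ![0, η * M * μ, 0, -(η * M) ^ 2 / x 2 ^ 2, 0, 0] ∈
        ptSpan (motorD₂ μ η M np τL J) x := by
      rw [D2_eq μ η M np τL J hη hM hx]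
      refine K_le μ η M hη hM x ⟨by simp [hv0], ?_⟩
      simp [hc]
      field_simp
      ring
    have := Submodule.add_mem _ (hle hr) (Submodule.smul_mem _ c m)
    rwa [sub_add_cancel] at this

/-- For the induction motor model (nonzero constants, on the domain
`ψ_d > 0`): `D₂ = span{∂_{I_d}, ∂_{I_q}, ∂_{ψ_d}, ψ_d²μ∂_ω + Mη∂_ρ}` has rank 4 and
is non-involutive, `D₃ = span{∂_{I_d}, ∂_{I_q}, ∂_{ψ_d}, ∂_ω, ∂_ρ}` is involutive of
rank 5, `D₄` is the full tangent bundle, and the annihilator of `D₃` is spanned by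
`dθ`. -/
theorem stmt14 (μ η M np τL J : ℝ)
    (hμ : μ ≠ 0) (hη : η ≠ 0) (hM : M ≠ 0) (hnp : np ≠ 0) (hτL : τL ≠ 0) (hJ : J ≠ 0) :
    -- D₂ = span{∂_{I_d}, ∂_{I_q}, ∂_{ψ_d}, ψ_d²μ∂_ω + Mη∂_ρ}, rank 4
    (∀ x : Fin 6 → ℝ, x 2 > 0 →
        ptSpan (motorD₂ μ η M np τL J) x
          = Submodule.span ℝ
              {Pi.single 4 1, Pi.single 5 1, Pi.single 2 1,
                (μ * (x 2) ^ 2) • (Pi.single 1 1 : Fin 6 → ℝ)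
                  + (M * η) • (Pi.single 3 1 : Fin 6 → ℝ)} ∧
        Module.finrank ℝ (ptSpan (motorD₂ μ η M np τL J) x) = 4) ∧
    -- D₂ is non-involutive
    (∃ v ∈ motorD₂ μ η M np τL J, ∃ w ∈ motorD₂ μ η M np τL J,
        ∃ x : Fin 6 → ℝ, x 2 > 0 ∧ lieB v w x ∉ ptSpan (motorD₂ μ η M np τL J) x) ∧
    -- D₃ = span{∂_ω, ∂_{ψ_d}, ∂_ρ, ∂_{I_d}, ∂_{I_q}} = ker dθ, rank 5, involutive
    (∀ x : Fin 6 → ℝ, x 2 > 0 →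
        ptSpan (motorD₃ μ η M np τL J) x
          = LinearMap.ker (LinearMap.proj 0 : ((i : Fin 6) → ℝ) →ₗ[ℝ] ℝ) ∧
        Module.finrank ℝ (ptSpan (motorD₃ μ η M np τL J) x) = 5) ∧
    (∀ v ∈ motorD₃ μ η M np τL J, ∀ w ∈ motorD₃ μ η M np τL J,
        ∀ x : Fin 6 → ℝ, x 2 > 0 → lieB v w x ∈ ptSpan (motorD₃ μ η M np τL J) x) ∧
    -- D₄ is the full tangent space
    (∀ x : Fin 6 → ℝ, x 2 > 0 → ptSpan (motorD₄ μ η M np τL J) x = ⊤) ∧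
    -- the annihilator of D₃ is spanned by dθ
    (∀ x : Fin 6 → ℝ, x 2 > 0 → ∀ ξ : (Fin 6 → ℝ) →ₗ[ℝ] ℝ,
        (∀ v ∈ motorD₃ μ η M np τL J, ξ (v x) = 0) ↔
          ∃ c : ℝ, ξ = c • (LinearMap.proj 0 : ((i : Fin 6) → ℝ) →ₗ[ℝ] ℝ)) := by
  refine ⟨fun x hx => ⟨D2_eq μ η M np τL J hη hM hx, ?_⟩, ?_, fun x hx =>
    ⟨D3_eq μ η M np τL J hμ hη hM hx, ?_⟩, ?_, ?_, ?_⟩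
  · rw [D2_eq μ η M np τL J hη hM hx]
    exact rank_span_motor _ _ (mul_ne_zero hM hη)
  · refine ⟨_, w1_mem μ η M np τL J, _, w2_mem μ η M np τL J, fun _ => 1, one_pos, ?_⟩
    intro h
    have h2 := (D2_le μ η M np τL J (x := fun _ => 1) one_pos h).2
    rw [lie_w _ _ _ _ _ _ (one_pos : (fun _ : Fin 6 => (1 : ℝ)) 2 > 0)] at h2
    simp at h2
    have : 2 * (μ * (η * M) ^ 2) = 0 := by linear_combination h2
    simp [hμ, hη, hM] at this
  · rw [D3_eq μ η M np τL J hμ hη hM hx]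
    have hs : Function.Surjective (LinearMap.proj 0 : ((i : Fin 6) → ℝ) →ₗ[ℝ] ℝ) :=
      LinearMap.proj_surjective 0
    have h1 := LinearMap.finrank_range_add_finrank_ker
      (LinearMap.proj 0 : ((i : Fin 6) → ℝ) →ₗ[ℝ] ℝ)
    rw [LinearMap.range_eq_top.2 hs, finrank_top] at h1
    simp only [Module.finrank_self, Module.finrank_fintype_fun_eq_card, Fintype.card_fin] at h1
    omega
  · intro v hv w hw x hx
    have hz : ∀ u ∈ motorD₃ μ η M np τL J, ∀ y : Fin 6 → ℝ, y 2 > 0 → u y 0 = 0 := by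
      intro u hu y hy
      have := mem_ptSpan hu y
      rw [D3_eq μ η M np τL J hμ hη hM hy] at this
      exact this
    rw [D3_eq μ η M np τL J hμ hη hM hx]
    exact lieB_zero_comp (hz v hv) (hz w hw) hx
  · intro x hx
    have hx' : x 2 ≠ 0 := hx.ne'
    have hle : ptSpan (motorD₃ μ η M np τL J) x ≤ ptSpan (motorD₄ μ η M np τL J) x :=
      Submodule.span_mono (Set.image_mono (Set.subset_union_left.trans (sub_smooth _)))
    have hw3 : lieB (motorF μ η M np τL J) motorG₂ ∈ motorD₃ μ η M np τL J :=
      sub_smooth _ (Or.inl (w2_mem μ η M np τL J))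
    have m := mem_ptSpan (sub_smooth _ (Or.inr ⟨_, hw3, rfl⟩) :
      lieB (motorF μ η M np τL J) (lieB (motorF μ η M np τL J) motorG₂)
        ∈ motorD₄ μ η M np τL J) x
    set b := lieB (motorF μ η M np τL J) (lieB (motorF μ η M np τL J) motorG₂) x with hb
    have hb0 : b 0 = μ * x 2 := by
      rw [hb, lieB, fderiv_motorF μ η M np τL J hx, Pi.sub_apply,
        fderiv_comp_zero ((ev_pos hx).mono fun y hy =>
          D2_zero μ η M np τL J (w2_mem μ η M np τL J) hy), lie_G2 _ _ _ _ _ _ hx]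
      simp
    rw [eq_top_iff]
    intro v _
    have hr : v - (v 0 / (μ * x 2)) • b ∈ ptSpan (motorD₃ μ η M np τL J) x := by
      rw [D3_eq μ η M np τL J hμ hη hM hx, LinearMap.mem_ker]
      simp [hb0]
      field_simp
      simp
    have := Submodule.add_mem _ (hle hr) (Submodule.smul_mem _ (v 0 / (μ * x 2)) m)
    simpa using this
  · intro x hx ξ
    constructor
    · intro h
      have hk : ptSpan (motorD₃ μ η M np τL J) x ≤ LinearMap.ker ξ := by
        refine Submodule.span_le.2 ?_
        rintro _ ⟨v, hv, rfl⟩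
        exact h v hv
      rw [D3_eq μ η M np τL J hμ hη hM hx] at hk
      refine ⟨ξ (Pi.single 0 1), LinearMap.ext fun v => ?_⟩
      have hv : v - v 0 • (Pi.single 0 1 : Fin 6 → ℝ) ∈ LinearMap.ker ξ := hk (by simp)
      rw [LinearMap.mem_ker, map_sub, map_smul, sub_eq_zero] at hv
      rw [hv]
      simp [mul_comm]
    · rintro ⟨c, rfl⟩ v hv
      have := mem_ptSpan hv x
      rw [D3_eq μ η M np τL J hμ hη hM hx] at this
      have h0 : v x 0 = 0 := this
      simp [h0]
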